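/- arXiv:0801.2486 — 2 statements merged into one kernel-verified Lean document; each statement's English description precedes it below -/
import Mathlib

section
/- Let (R, d) be a compact metric space. Then there exists a compact subset K of the Banach space C(R) of real-valued continuous functions on R with the supremum norm such that for every real Banach space Y, if there exists a distance-preserving map from K into Y, then there exists a linear isometric embedding of C(R) into Y. -/
open MeasureTheory Set Function

open scoped NNReal

/-! ### Functions separately Lipschitz in countably many real variables -/

section Averaging

variable {Y : Type*} [NormedAddCommGroup Y]

/-- The uniform distribution on the unit interval, as a measure on `ℝ`. -/
noncomputable def uniformUnit : Measure ℝ := volume.restrict (Ioc 0 1)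

instance isProbabilityMeasure_uniformUnit : IsProbabilityMeasure uniformUnit :=
  ⟨by simp [uniformUnit]⟩

/-- The law of a sequence of independent uniform variables on the unit interval. -/
noncomputable def uniformCube : Measure (ℕ → ℝ) := Measure.infinitePi fun _ => uniformUnit

instance isProbabilityMeasure_uniformCube : IsProbabilityMeasure uniformCube := by
  unfold uniformCube; infer_instance

theorem ae_uniformCube_mem_Icc : ∀ᵐ t ∂uniformCube, ∀ k, t k ∈ Icc (0 : ℝ) 1 := by
  rw [ae_all_iff]
  intro k
  have h : ∀ᵐ r ∂uniformUnit, r ∈ Icc (0 : ℝ) 1 := by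
    filter_upwards [ae_restrict_mem (μ := volume) (measurableSet_Ioc (a := (0 : ℝ)) (b := 1))]
      with r hr using Ioc_subset_Icc_self hr
  have hm : MeasurePreserving (fun t : ℕ → ℝ => t k) uniformCube uniformUnit :=
    measurePreserving_eval_infinitePi (fun _ => uniformUnit) k
  exact hm.quasiMeasurePreserving.ae h

/-- Resampling one coordinate does not change the law. -/
theorem measurePreserving_update_uniformCube (n : ℕ) :
    MeasurePreserving (fun p : (ℕ → ℝ) × ℝ => update p.1 n p.2)
      (uniformCube.prod uniformUnit) uniformCube := by
  have hmeas : Measurable fun p : (ℕ → ℝ) × ℝ => update p.1 n p.2 := by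
    refine measurable_pi_lambda _ fun k => ?_
    by_cases hk : k = n
    · subst hk; simpa using measurable_snd
    · simp only [update_of_ne hk]
      exact (measurable_pi_apply k).comp measurable_fst
  refine ⟨hmeas, Measure.eq_infinitePi _ fun s t ht => ?_⟩
  have hpre : (fun p : (ℕ → ℝ) × ℝ => update p.1 n p.2) ⁻¹' (Set.pi s t) =
      (Set.pi (s.erase n : Finset ℕ) t) ×ˢ (if n ∈ s then t n else univ) := by
    ext ⟨u, r⟩
    simp only [mem_preimage, Set.mem_pi, mem_prod, Finset.mem_coe, Finset.mem_erase]
    constructor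
    · intro h
      refine ⟨fun i hi => by simpa [hi.1] using h i hi.2, ?_⟩
      split_ifs with hn
      · simpa using h n hn
      · trivial
    · rintro ⟨h₁, h₂⟩ i hi
      by_cases hin : i = n
      · subst hin; simpa [hi] using h₂
      · simpa [hin] using h₁ i ⟨hin, hi⟩
  rw [Measure.map_apply hmeas (MeasurableSet.pi s.countable_toSet fun i _ => ht i), hpre,
    Measure.prod_prod, uniformCube, Measure.infinitePi_pi _ fun i _ => ht i]
  split_ifs with hn
  · rw [Finset.prod_erase_mul _ _ hn]
  · simp [Finset.erase_eq_of_notMem hn]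

/-- A bounded continuous function of countably many real variables which is `1`-Lipschitz in each
variable. -/
structure SepLipschitz (F : (ℕ → ℝ) → Y) : Prop where
  continuous : Continuous F
  bounded : ∃ C, ∀ t, ‖F t‖ ≤ C
  norm_update_sub_le : ∀ t n r s, ‖F (update t n r) - F (update t n s)‖ ≤ |r - s|

namespace SepLipschitz

variable {F : (ℕ → ℝ) → Y}

theorem integrable_comp (hF : SepLipschitz F) {α : Type*} [TopologicalSpace α]
    [SecondCountableTopology α] [MeasurableSpace α] [OpensMeasurableSpace α] {μ : Measure α}
    [IsFiniteMeasure μ] {g : α → ℕ → ℝ} (hg : Continuous g) : Integrable (fun x => F (g x)) μ := by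
  obtain ⟨C, hC⟩ := hF.bounded
  exact Integrable.of_bound (hF.continuous.comp hg).aestronglyMeasurable C
    (Filter.Eventually.of_forall fun x => hC _)

theorem norm_add_piecewise_sub_le (hF : SepLipschitz F) (a t : ℕ → ℝ) (S : Finset ℕ) :
    ‖F (t + S.piecewise a 0) - F t‖ ≤ ∑ k ∈ S, |a k| := by
  induction S using Finset.induction_on with
  | empty => simp
  | insert n S hn ih =>
    have hb : S.piecewise a 0 n = 0 := by simp [hn]
    have h1 : t + (insert n S).piecewise a 0 = update (t + S.piecewise a 0) n (t n + a n) := by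
      rw [Finset.piecewise_insert]
      ext k
      by_cases hk : k = n
      · subst hk; simp
      · simp [hk]
    have h2 := hF.norm_update_sub_le (t + S.piecewise a 0) n (t n + a n) (t n)
    have h3 : update (t + S.piecewise a 0) n (t n) = t + S.piecewise a 0 := by
      rw [update_eq_self_iff]; simp [hn]
    rw [h3, ← h1] at h2
    rw [Finset.sum_insert hn]
    have h4 : t n + a n - t n = a n := by ring
    rw [h4] at h2
    calc _ ≤ _ := norm_sub_le_norm_sub_add_norm_sub _ (F (t + S.piecewise a 0)) _
      _ ≤ _ := add_le_add h2 ih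

end SepLipschitz

variable [NormedSpace ℝ Y]

/-- The averaged increment of `F` between opposite faces of the unit cube. -/
noncomputable def meanIncrement (F : (ℕ → ℝ) → Y) (n : ℕ) : Y :=
  ∫ t, (F (update t n 1) - F (update t n 0)) ∂uniformCube

theorem update_add_eq_add_update {t b : ℕ → ℝ} {n : ℕ} (hb : b n = 0) (r : ℝ) :
    update t n r + b = update (t + b) n r := by
  ext k
  by_cases hk : k = n
  · subst hk; simp [hb]
  · simp [hk]

theorem norm_integral_comp_add_sub_le {f : ℝ → Y} (hf : Continuous f)
    (hlip : ∀ r s, ‖f r - f s‖ ≤ |r - s|) (s : ℝ) [CompleteSpace Y] :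
    ‖(∫ r in (0 : ℝ)..1, (f (r + s) - f r)) - s • (f 1 - f 0)‖ ≤ 2 * s ^ 2 := by
  have hint : ∀ a b : ℝ, IntervalIntegrable f volume a b := fun a b => hf.intervalIntegrable a b
  have key : ∀ a : ℝ, ‖(∫ r in a..(a + s), f r) - s • f a‖ ≤ s ^ 2 := by
    intro a
    have h1 : (∫ r in a..(a + s), f r) - s • f a = ∫ r in a..(a + s), (f r - f a) := by
      rw [intervalIntegral.integral_sub (hint _ _) (by simp)]
      simp
    rw [h1]
    have h2 : ∀ r ∈ Set.uIoc a (a + s), ‖f r - f a‖ ≤ |s| := by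
      intro r hr
      refine (hlip r a).trans ?_
      have := Set.abs_sub_left_of_mem_uIcc (Set.uIoc_subset_uIcc hr)
      simpa using this
    refine (intervalIntegral.norm_integral_le_of_norm_le_const h2).trans ?_
    simp [← sq]
  have hshift : IntervalIntegrable (fun r => f (r + s)) volume 0 1 :=
    (hf.comp (continuous_add_const s)).intervalIntegrable _ _
  have h3 : (∫ r in (0 : ℝ)..1, (f (r + s) - f r)) =
      (∫ r in (1 : ℝ)..(1 + s), f r) - ∫ r in (0 : ℝ)..(0 + s), f r := by
    rw [intervalIntegral.integral_sub hshift (hint _ _),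
      intervalIntegral.integral_comp_add_right,
      intervalIntegral.integral_interval_sub_interval_comm' (hint _ _) (hint _ _) (hint _ _)]
  rw [h3]
  calc _ = ‖((∫ r in (1 : ℝ)..(1 + s), f r) - s • f 1) -
        ((∫ r in (0 : ℝ)..(0 + s), f r) - s • f 0)‖ := by
        congr 1; rw [smul_sub]; abel
    _ ≤ _ := (norm_sub_le _ _).trans (by linarith [key 1, key 0])

theorem integral_uniformUnit (g : ℝ → Y) :
    ∫ r, g r ∂uniformUnit = ∫ r in (0 : ℝ)..1, g r := by
  rw [intervalIntegral.integral_of_le zero_le_one, uniformUnit]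

namespace SepLipschitz

variable {F : (ℕ → ℝ) → Y}

theorem norm_integral_update_sub_le [CompleteSpace Y] (hF : SepLipschitz F) {b : ℕ → ℝ} {n : ℕ}
    (hb : b n = 0) (s : ℝ) {A : ℝ} (hA : ∀ t, ‖F (t + b) - F t‖ ≤ A) :
    ‖(∫ t, F (update (t + b) n (t n + s)) ∂uniformCube) - (∫ t, F (t + b) ∂uniformCube)
      - s • meanIncrement F n‖ ≤ 2 * s ^ 2 + 2 * |s| * A := by
  have hc1 : Continuous fun t : ℕ → ℝ => update (t + b) n (t n + s) := by fun_prop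
  have hc2 : Continuous fun t : ℕ → ℝ => t + b := by fun_prop
  have hc3 : ∀ r : ℝ, Continuous fun t : ℕ → ℝ => update t n r := fun r => by fun_prop
  set G : (ℕ → ℝ) → Y := fun t => F (update (t + b) n (t n + s)) - F (t + b) -
    s • (F (update t n 1) - F (update t n 0)) with hG
  have hi1 : Integrable (fun t => F (update (t + b) n (t n + s)) - F (t + b)) uniformCube :=
    (hF.integrable_comp hc1).sub (hF.integrable_comp hc2)
  have hi2 : Integrable (fun t => s • (F (update t n 1) - F (update t n 0))) uniformCube :=
    ((hF.integrable_comp (hc3 1)).sub (hF.integrable_comp (hc3 0))).smul s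
  have hGint : Integrable G uniformCube := hi1.sub hi2
  have hGeq : (∫ t, F (update (t + b) n (t n + s)) ∂uniformCube) - (∫ t, F (t + b) ∂uniformCube)
      - s • meanIncrement F n = ∫ t, G t ∂uniformCube := by
    rw [meanIncrement, ← integral_smul, ← integral_sub (hF.integrable_comp hc1)
      (hF.integrable_comp hc2), ← integral_sub hi1 hi2]
  have hmp := measurePreserving_update_uniformCube n
  have hres : ∫ t, G t ∂uniformCube =
      ∫ t, ∫ r, G (update t n r) ∂uniformUnit ∂uniformCube := by
    have hGm : AEStronglyMeasurable G
        ((uniformCube.prod uniformUnit).map fun p : (ℕ → ℝ) × ℝ => update p.1 n p.2) := by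
      rw [hmp.map_eq]; exact hGint.aestronglyMeasurable
    conv_lhs => rw [← hmp.map_eq]
    rw [integral_map hmp.measurable.aemeasurable hGm]
    exact integral_prod _ (hmp.integrable_comp_of_integrable hGint)
  have hinner : ∀ t, ‖∫ r, G (update t n r) ∂uniformUnit‖ ≤ 2 * s ^ 2 + 2 * |s| * A := by
    intro t
    set f : ℝ → Y := fun r => F (update (t + b) n r) with hf
    set g : ℝ → Y := fun r => F (update t n r) with hg
    have hfc : Continuous f := hF.continuous.comp (by fun_prop)
    have hfg : ∀ r, ‖f r - g r‖ ≤ A := by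
      intro r
      have := hA (update t n r)
      rwa [update_add_eq_add_update hb] at this
    have hGf : ∀ r, G (update t n r) = (f (r + s) - f r) - s • (g 1 - g 0) := by
      intro r
      simp only [hG, hf, hg, update_add_eq_add_update hb, update_idem, update_self]
    have hInt : ∫ r, G (update t n r) ∂uniformUnit =
        (∫ r in (0 : ℝ)..1, (f (r + s) - f r)) - s • (g 1 - g 0) := by
      have hfi : IntervalIntegrable (fun r => f (r + s) - f r) volume 0 1 :=
        ((hfc.comp (continuous_add_const s)).sub hfc).intervalIntegrable _ _
      rw [integral_uniformUnit, intervalIntegral.integral_congr fun r _ => hGf r,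
        intervalIntegral.integral_sub hfi (by simp)]
      simp
    have h1 := norm_integral_comp_add_sub_le hfc (hF.norm_update_sub_le (t + b) n) s
    have h2 : ‖s • ((f 1 - g 1) - (f 0 - g 0))‖ ≤ 2 * |s| * A := by
      rw [norm_smul, Real.norm_eq_abs]
      have := (norm_sub_le (f 1 - g 1) (f 0 - g 0)).trans (add_le_add (hfg 1) (hfg 0))
      nlinarith [mul_le_mul_of_nonneg_left this (abs_nonneg s)]
    rw [hInt]
    calc _ = ‖((∫ r in (0 : ℝ)..1, (f (r + s) - f r)) - s • (f 1 - f 0)) +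
          s • ((f 1 - g 1) - (f 0 - g 0))‖ := by
          congr 1; simp only [smul_sub]; abel
      _ ≤ _ := (norm_add_le _ _).trans (add_le_add h1 h2)
  rw [hGeq, hres]
  refine (norm_integral_le_of_norm_le_const (Filter.Eventually.of_forall hinner)).trans ?_
  simp

/-- The average of `F` over translates of the unit cube is differentiable at the origin, with
partial derivatives `meanIncrement F`. -/
theorem norm_integral_sub_sum_le [CompleteSpace Y] (hF : SepLipschitz F) (a : ℕ → ℝ)
    (S : Finset ℕ) :
    ‖(∫ t, F (t + S.piecewise a 0) ∂uniformCube) - (∫ t, F t ∂uniformCube)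
      - ∑ k ∈ S, a k • meanIncrement F k‖ ≤ 2 * (∑ k ∈ S, |a k|) ^ 2 := by
  induction S using Finset.induction_on with
  | empty => simp
  | insert n S hn ih =>
    have hb : S.piecewise a 0 n = 0 := by simp [hn]
    have h1 : ∀ t : ℕ → ℝ,
        t + (insert n S).piecewise a 0 = update (t + S.piecewise a 0) n (t n + a n) := by
      intro t
      rw [Finset.piecewise_insert]
      ext k
      by_cases hk : k = n
      · subst hk; simp
      · simp [hk]
    have h2 := hF.norm_integral_update_sub_le hb (a n)
      (fun t => hF.norm_add_piecewise_sub_le a t S)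
    simp only [h1]
    rw [Finset.sum_insert hn, Finset.sum_insert hn]
    have hA : 0 ≤ ∑ k ∈ S, |a k| := Finset.sum_nonneg fun _ _ => abs_nonneg _
    have hs := abs_nonneg (a n)
    calc _ = ‖((∫ t, F (update (t + S.piecewise a 0) n (t n + a n)) ∂uniformCube)
            - (∫ t, F (t + S.piecewise a 0) ∂uniformCube) - a n • meanIncrement F n)
          + ((∫ t, F (t + S.piecewise a 0) ∂uniformCube) - (∫ t, F t ∂uniformCube)
            - ∑ k ∈ S, a k • meanIncrement F k)‖ := by congr 1; abel
      _ ≤ _ := (norm_add_le _ _).trans (add_le_add h2 ih)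
      _ ≤ _ := by
        rw [← sq_abs (a n)]
        nlinarith [mul_nonneg hs hA]

/-- If, on the unit cube, the increments of `F` are controlled by the norm of the corresponding
combinations of the `x k`, then so are the combinations of its mean increments. -/
theorem norm_sum_smul_meanIncrement_le [CompleteSpace Y] (hF : SepLipschitz F)
    {E : Type*} [NormedAddCommGroup E] [NormedSpace ℝ E] {x : ℕ → E}
    (hx : ∀ (t : ℕ → ℝ) (a : ℕ → ℝ) (S : Finset ℕ), (∀ k, t k ∈ Icc (0 : ℝ) 1) →
      (∀ k ∈ S, |a k| ≤ 1) → ‖F (t + S.piecewise a 0) - F t‖ ≤ ‖∑ k ∈ S, a k • x k‖)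
    (a : ℕ → ℝ) (S : Finset ℕ) :
    ‖∑ k ∈ S, a k • meanIncrement F k‖ ≤ ‖∑ k ∈ S, a k • x k‖ := by
  set A := ∑ k ∈ S, |a k| with hA
  have hA0 : 0 ≤ A := Finset.sum_nonneg fun _ _ => abs_nonneg _
  have main : ∀ ε : ℝ, 0 < ε → ε * A ≤ 1 →
      ‖∑ k ∈ S, a k • meanIncrement F k‖ ≤ ‖∑ k ∈ S, a k • x k‖ + 2 * ε * A ^ 2 := by
    intro ε hε hεA
    have h1 := hF.norm_integral_sub_sum_le (fun k => ε * a k) S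
    have hle : ∀ k ∈ S, |ε * a k| ≤ 1 := by
      intro k hk
      rw [abs_mul, abs_of_pos hε]
      exact (mul_le_mul_of_nonneg_left
        (Finset.single_le_sum (f := fun k => |a k|) (fun _ _ => abs_nonneg _) hk) hε.le).trans hεA
    have h2 : ‖(∫ t, F (t + S.piecewise (fun k => ε * a k) 0) ∂uniformCube) -
        (∫ t, F t ∂uniformCube)‖ ≤ ‖∑ k ∈ S, (ε * a k) • x k‖ := by
      have hi : Integrable (fun t => F (t + S.piecewise (fun k => ε * a k) 0)) uniformCube :=
        hF.integrable_comp (by fun_prop)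
      have hi0 : Integrable F uniformCube := hF.integrable_comp continuous_id
      rw [← integral_sub hi hi0]
      refine (norm_integral_le_of_norm_le_const (C := ‖∑ k ∈ S, (ε * a k) • x k‖) ?_).trans
        (by simp)
      filter_upwards [ae_uniformCube_mem_Icc] with t ht using hx t _ S ht hle
    have h4 : ∑ k ∈ S, |ε * a k| = ε * A := by
      simp only [abs_mul, abs_of_pos hε]
      rw [← Finset.mul_sum]
    rw [h4] at h1
    have h6 := (norm_le_norm_add_norm_sub _ _).trans (add_le_add h2 h1)
    simp only [mul_smul, ← Finset.smul_sum, norm_smul, Real.norm_eq_abs, abs_of_pos hε] at h6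
    have h7 : ε * ‖∑ k ∈ S, a k • meanIncrement F k‖ ≤
        ε * (‖∑ k ∈ S, a k • x k‖ + 2 * ε * A ^ 2) := by
      calc _ ≤ _ := h6
        _ = _ := by ring
    exact le_of_mul_le_mul_left h7 hε
  refine le_of_forall_pos_le_add fun δ hδ => ?_
  have hpos : 0 < 1 + A + 2 * A ^ 2 / δ := by positivity
  refine (main (1 + A + 2 * A ^ 2 / δ)⁻¹ (inv_pos.2 hpos) ?_).trans ?_
  · rw [inv_mul_le_iff₀ hpos]
    have : 0 ≤ 2 * A ^ 2 / δ := by positivity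
    linarith
  · gcongr
    have h1 : 2 * A ^ 2 ≤ δ * (1 + A + 2 * A ^ 2 / δ) := by
      have : δ * (2 * A ^ 2 / δ) = 2 * A ^ 2 := by field_simp
      nlinarith [mul_nonneg hδ.le hA0]
    calc _ = (2 * A ^ 2) / (1 + A + 2 * A ^ 2 / δ) := by ring
      _ ≤ δ := (div_le_iff₀ hpos).2 h1

theorem apply_meanIncrement [CompleteSpace Y] (hF : SepLipschitz F) (y : StrongDual ℝ Y) (n : ℕ)
    {c : ℝ} (hc : ∀ t, y (F (update t n 1)) - y (F (update t n 0)) = c) :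
    y (meanIncrement F n) = c := by
  have hi : ∀ r : ℝ, Integrable (fun t => F (update t n r)) uniformCube := fun r =>
    hF.integrable_comp (by fun_prop)
  rw [meanIncrement, integral_sub (hi 1) (hi 0), map_sub, ← y.integral_comp_comm (hi 1),
    ← y.integral_comp_comm (hi 0),
    ← integral_sub (y.integrable_comp (hi 1)) (y.integrable_comp (hi 0))]
  simp [hc]

end SepLipschitz

end Averaging

/-! ### Lipschitz functions on a compact metric space -/

section Lipschitz

variable {R : Type*} [MetricSpace R] [CompactSpace R]

theorem isCompact_setOf_lipschitzWith_norm_le (L : ℝ≥0) (M : ℝ) :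
    IsCompact {g : C(R, ℝ) | LipschitzWith L g ∧ ‖g‖ ≤ M} := by
  have hcl : IsClosed {g : C(R, ℝ) | LipschitzWith L g ∧ ‖g‖ ≤ M} := by
    have h : {g : C(R, ℝ) | LipschitzWith L g} =
        ⋂ p, ⋂ q, {g : C(R, ℝ) | dist (g p) (g q) ≤ L * dist p q} := by
      ext g; simp [lipschitzWith_iff_dist_le_mul]
    have hL : IsClosed {g : C(R, ℝ) | LipschitzWith L g} := by
      rw [h]
      refine isClosed_iInter fun p => isClosed_iInter fun q => isClosed_le ?_ continuous_const
      exact (continuous_eval_const p).dist (continuous_eval_const q)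
    exact hL.inter (isClosed_le continuous_norm continuous_const)
  let e := ContinuousMap.isometryEquivBoundedOfCompact R ℝ
  have h : IsCompact (e.symm ⁻¹' {g : C(R, ℝ) | LipschitzWith L g ∧ ‖g‖ ≤ M}) := by
    refine BoundedContinuousFunction.arzela_ascoli₂ (Metric.closedBall (0 : ℝ) M)
      (isCompact_closedBall _ _) _ (hcl.preimage e.symm.continuous) ?_ ?_
    · intro f p hf
      exact mem_closedBall_zero_iff.2 (((e.symm f).norm_coe_le_norm p).trans hf.2)
    · refine LipschitzWith.uniformEquicontinuous _ L ?_ |>.equicontinuous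
      rintro ⟨f, hf⟩
      exact hf.1
  have h2 := h.image e.symm.continuous
  rwa [image_preimage_eq _ e.symm.surjective] at h2

theorem dense_setOf_lipschitzWith :
    Dense {g : C(R, ℝ) | ∃ L : ℝ≥0, LipschitzWith L g} := by
  rw [dense_iff_closure_eq]
  refine ContinuousMap.sublattice_closure_eq_top _ ⟨0, 0, LipschitzWith.const 0⟩ ?_ ?_ ?_
  · rintro f ⟨L, hf⟩ g ⟨L', hg⟩
    exact ⟨_, hf.min hg⟩
  · rintro f ⟨L, hf⟩ g ⟨L', hg⟩
    exact ⟨_, hf.max hg⟩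
  · intro v p q
    have hlip : LipschitzWith (Real.nnabs ((v q - v p) / dist q p))
        fun s => v p + (v q - v p) / dist q p * dist s p := by
      refine LipschitzWith.of_dist_le_mul fun s t => ?_
      rw [dist_add_left, Real.dist_eq, ← mul_sub, abs_mul]
      exact mul_le_mul_of_nonneg_left (abs_dist_sub_le s t p) (abs_nonneg _)
    refine ⟨⟨_, hlip.continuous⟩, ⟨_, hlip⟩, by simp, ?_⟩
    by_cases hpq : q = p
    · subst hpq; simp
    · simp [div_mul_cancel₀ _ (dist_ne_zero.2 hpq)]

/-- `C(R)` is the closed span of a sequence of functions whose norms and Lipschitz constants are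
as small as desired. -/
theorem exists_seq_small_lipschitz {w : ℕ → ℝ≥0} (hw : ∀ k, 0 < w k) :
    ∃ x : ℕ → C(R, ℝ), (∀ k, ‖x k‖ ≤ w k) ∧ (∀ k, LipschitzWith (w k) (x k)) ∧
      DenseRange (Finsupp.linearCombination ℝ x) := by
  obtain ⟨T, hTsub, hTc, hTd⟩ :=
    (dense_setOf_lipschitzWith (R := R)).exists_countable_dense_subset
  obtain ⟨g, rfl⟩ := hTc.exists_eq_range hTd.nonempty
  have hg : ∀ k, ∃ L : ℝ≥0, LipschitzWith L (g k) := fun k => hTsub (mem_range_self k)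
  choose L hL using hg
  set c : ℕ → ℝ≥0 := fun k => w k / (1 + ‖g k‖₊ + L k) with hc
  have hcpos : ∀ k, 0 < c k := fun k => div_pos (hw k) (by positivity)
  have hcle : ∀ k, ∀ v : ℝ≥0, v ≤ 1 + ‖g k‖₊ + L k → c k * v ≤ w k := by
    intro k v hv
    calc c k * v ≤ c k * (1 + ‖g k‖₊ + L k) := by gcongr
      _ = w k := div_mul_cancel₀ _ (by positivity)
  refine ⟨fun k => (c k : ℝ) • g k, fun k => ?_, fun k => ?_, ?_⟩
  · have := hcle k ‖g k‖₊ (by rw [add_right_comm]; exact le_add_self)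
    rw [norm_smul]
    simpa using (NNReal.coe_le_coe.2 this)
  · refine LipschitzWith.of_dist_le_mul fun p q => ?_
    have h1 := (hL k).dist_le_mul p q
    have h2 : (c k : ℝ) * L k ≤ w k := by
      exact_mod_cast hcle k (L k) le_add_self
    simp only [ContinuousMap.coe_smul, Pi.smul_apply, dist_smul₀, Real.norm_eq_abs,
      NNReal.abs_eq]
    calc (c k : ℝ) * dist (g k p) (g k q) ≤ c k * (L k * dist p q) := by gcongr
      _ = (c k * L k) * dist p q := by ring
      _ ≤ _ := by gcongr
  · refine hTd.mono ?_
    rintro _ ⟨k, rfl⟩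
    refine ⟨Finsupp.single k (c k : ℝ)⁻¹, ?_⟩
    have : (c k : ℝ) ≠ 0 := by exact_mod_cast (hcpos k).ne'
    simp [Finsupp.linearCombination_single, smul_smul, this]

/-- An isometric copy of a ball of `1`-Lipschitz functions carries norm one functionals which
act on small functions as evaluations do. -/
theorem exists_dual_apply_sub_eq {Y : Type*} [NormedAddCommGroup Y] [NormedSpace ℝ Y]
    {K : Set C(R, ℝ)}
    (hK : K = {g : C(R, ℝ) | LipschitzWith 1 g ∧ ‖g‖ ≤ 1 + Metric.diam (univ : Set R)})
    {j : K → Y} (hj : Isometry j) (p : R) :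
    ∃ y : StrongDual ℝ Y, ‖y‖ ≤ 1 ∧ ∃ c : ℝ, ∀ g : K, ‖(g : C(R, ℝ))‖ ≤ 1 →
      y (j g) = g.1 p + c := by
  set M := 1 + Metric.diam (univ : Set R) with hM
  have hd : ∀ s, dist s p ≤ M - 1 := fun s => by
    have := Metric.dist_le_diam_of_mem (isCompact_univ (X := R)).isBounded
      (mem_univ s) (mem_univ p)
    linarith
  have hM1 : 1 ≤ M := by linarith [Metric.diam_nonneg (s := (univ : Set R))]
  have hlip : LipschitzWith 1 fun s => M - dist s p := by
    refine LipschitzWith.of_dist_le_mul fun s t => ?_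
    rw [dist_sub_left, Real.dist_eq]
    simpa using abs_dist_sub_le s t p
  let f : C(R, ℝ) := ⟨_, hlip.continuous⟩
  have hfa : ∀ s, f s = M - dist s p := fun s => rfl
  have hfn : ‖f‖ ≤ M := by
    rw [ContinuousMap.norm_le _ (by linarith)]
    intro s
    rw [hfa, Real.norm_eq_abs, abs_le]
    constructor <;> linarith [hd s, dist_nonneg (x := s) (y := p)]
  have hfK : f ∈ K := by rw [hK]; exact ⟨hlip, hfn⟩
  have hfK' : -f ∈ K := by rw [hK]; exact ⟨hlip.neg, by rwa [norm_neg]⟩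
  have hfar : 2 * M ≤ ‖j ⟨f, hfK⟩ - j ⟨-f, hfK'⟩‖ := by
    rw [← dist_eq_norm, hj.dist_eq, Subtype.dist_eq, dist_eq_norm]
    have := (f - -f).norm_coe_le_norm p
    have h2 : (f - -f) p = 2 * M := by simp [hfa]; ring
    rw [h2, Real.norm_eq_abs] at this
    exact (le_abs_self _).trans this
  obtain ⟨y, hy1, hy2⟩ := exists_dual_vector'' ℝ (j ⟨f, hfK⟩ - j ⟨-f, hfK'⟩)
  refine ⟨y, hy1, y (j ⟨f, hfK⟩) - M, ?_⟩
  have hyle : ∀ u v : K, y (j u) - y (j v) ≤ ‖(u : C(R, ℝ)) - v‖ := by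
    intro u v
    rw [← map_sub, ← dist_eq_norm, ← Subtype.dist_eq, ← hj.dist_eq, dist_eq_norm]
    exact (le_abs_self _).trans ((y.le_of_opNorm_le hy1 _).trans (by simp))
  have hclose : ∀ g : C(R, ℝ), LipschitzWith 1 g → ‖g‖ ≤ 1 → ‖f - g‖ ≤ M - g p := by
    intro g hg hg1
    have hb : ∀ s, |g s| ≤ 1 := fun s => (g.norm_coe_le_norm s).trans hg1
    rw [ContinuousMap.norm_le _ (by linarith [(abs_le.1 (hb p)).2])]
    intro s
    have h1 : |g s - g p| ≤ dist s p := by simpa [Real.dist_eq] using hg.dist_le_mul s p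
    rw [ContinuousMap.sub_apply, hfa, Real.norm_eq_abs, abs_le]
    constructor <;> linarith [hd s, (abs_le.1 (hb s)).2, (abs_le.1 (hb p)).2, (abs_le.1 h1).1]
  rintro ⟨g, hgK⟩ hg1
  have hg : LipschitzWith 1 g := by rw [hK] at hgK; exact hgK.1
  have h1 := (hyle ⟨f, hfK⟩ ⟨g, hgK⟩).trans (hclose g hg hg1)
  have h2 : y (j ⟨g, hgK⟩) - y (j ⟨-f, hfK'⟩) ≤ M + g p := by
    refine (hyle _ _).trans ?_
    have := hclose (-g) hg.neg (by rwa [norm_neg])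
    simpa [add_comm] using this
  have h3 : y (j ⟨f, hfK⟩) - y (j ⟨-f, hfK'⟩) = ‖j ⟨f, hfK⟩ - j ⟨-f, hfK'⟩‖ := by
    rw [← map_sub]; exact hy2
  simp only
  linarith

end Lipschitz

/-- A linear isometric embedding is determined by its values on a sequence with dense span. -/
theorem nonempty_linearIsometry_of_norm_linearCombination {ι E Y : Type*} [NormedAddCommGroup E]
    [NormedSpace ℝ E] [NormedAddCommGroup Y] [NormedSpace ℝ Y] [CompleteSpace Y] {x : ι → E}
    {D : ι → Y} (hx : DenseRange (Finsupp.linearCombination ℝ x))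
    (h : ∀ a, ‖Finsupp.linearCombination ℝ D a‖ = ‖Finsupp.linearCombination ℝ x a‖) :
    Nonempty (E →ₗᵢ[ℝ] Y) := by
  set T := (Finsupp.linearCombination ℝ D).extendOfNorm (Finsupp.linearCombination ℝ x) with hT
  refine ⟨⟨T.toLinearMap, fun v => ?_⟩⟩
  refine hx.induction_on (p := fun v => ‖T v‖ = ‖v‖) v
    (isClosed_eq T.continuous.norm continuous_norm) fun a => ?_
  rw [hT, LinearMap.extendOfNorm_eq hx ⟨1, fun a => by rw [h, one_mul]⟩, h]

/-- Truncation of a real number to `[-1, 2]`. -/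
noncomputable def clampReal (r : ℝ) : ℝ := projIcc (-1 : ℝ) 2 (by norm_num) r

theorem continuous_clampReal : Continuous clampReal :=
  continuous_subtype_val.comp continuous_projIcc

theorem abs_clampReal_le (r : ℝ) : |clampReal r| ≤ 2 := by
  have := (projIcc (-1 : ℝ) 2 (by norm_num) r).2
  exact abs_le.2 ⟨(by norm_num : (-2 : ℝ) ≤ -1).trans this.1, this.2⟩

theorem clampReal_of_mem {r : ℝ} (hr : r ∈ Icc (-1 : ℝ) 2) : clampReal r = r := by
  rw [clampReal, projIcc_of_mem _ hr]

theorem abs_clampReal_sub_le (r s : ℝ) : |clampReal r - clampReal s| ≤ |r - s| := by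
  simpa [Real.dist_eq, Subtype.dist_eq, clampReal] using
    (LipschitzWith.projIcc (a := (-1 : ℝ)) (b := 2) (by norm_num)).dist_le_mul r s

section ClampedSum

variable {E : Type*} [NormedAddCommGroup E] [NormedSpace ℝ E]

/-- The sum of a series with coefficients truncated to `[-1, 2]`. -/
noncomputable def clampedSum (x : ℕ → E) (t : ℕ → ℝ) : E := ∑' k, clampReal (t k) • x k

variable {x : ℕ → E} {w : ℕ → ℝ≥0}

theorem norm_clampReal_smul_le (hx : ∀ k, ‖x k‖ ≤ w k) (t : ℕ → ℝ) (k : ℕ) :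
    ‖clampReal (t k) • x k‖ ≤ 2 * w k := by
  rw [norm_smul]
  exact mul_le_mul (abs_clampReal_le _) (hx k) (norm_nonneg _) (by norm_num)

theorem norm_clampedSum_le (hx : ∀ k, ‖x k‖ ≤ w k) (hw : HasSum (fun k => (w k : ℝ)) (1 / 2))
    (t : ℕ → ℝ) : ‖clampedSum x t‖ ≤ 1 :=
  tsum_of_norm_bounded (by simpa using hw.mul_left 2) (norm_clampReal_smul_le hx t)

variable [CompleteSpace E]

theorem continuous_clampedSum (hx : ∀ k, ‖x k‖ ≤ w k) (hw : Summable fun k => (w k : ℝ)) :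
    Continuous (clampedSum x) :=
  continuous_tsum (fun k => (continuous_clampReal.comp (continuous_apply k)).smul continuous_const)
    (hw.mul_left 2) fun k t => norm_clampReal_smul_le hx t k

theorem summable_clampReal_smul (hx : ∀ k, ‖x k‖ ≤ w k) (hw : Summable fun k => (w k : ℝ))
    (t : ℕ → ℝ) : Summable fun k => clampReal (t k) • x k :=
  Summable.of_norm_bounded (hw.mul_left 2) (norm_clampReal_smul_le hx t)

theorem clampedSum_sub (hx : ∀ k, ‖x k‖ ≤ w k) (hw : Summable fun k => (w k : ℝ))
    (S : Finset ℕ) {t u : ℕ → ℝ} (h : ∀ k ∉ S, t k = u k) :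
    clampedSum x t - clampedSum x u =
      ∑ k ∈ S, (clampReal (t k) - clampReal (u k)) • x k := by
  rw [clampedSum, clampedSum, ← (summable_clampReal_smul hx hw t).tsum_sub
    (summable_clampReal_smul hx hw u), tsum_eq_sum (s := S)]
  · simp only [sub_smul]
  · intro k hk
    simp [h k hk]

theorem clampedSum_update_sub (hx : ∀ k, ‖x k‖ ≤ w k) (hw : Summable fun k => (w k : ℝ))
    (t : ℕ → ℝ) (n : ℕ) (r s : ℝ) :
    clampedSum x (update t n r) - clampedSum x (update t n s) =
      (clampReal r - clampReal s) • x n := by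
  rw [clampedSum_sub hx hw {n}]
  · simp
  · intro k hk
    simp [Finset.mem_singleton.not.1 hk]

end ClampedSum

theorem lipschitzWith_clampedSum {R : Type*} [MetricSpace R] [CompactSpace R] {x : ℕ → C(R, ℝ)}
    {w : ℕ → ℝ≥0} (hx : ∀ k, ‖x k‖ ≤ w k) (hxl : ∀ k, LipschitzWith (w k) (x k))
    (hw : HasSum (fun k => (w k : ℝ)) (1 / 2)) (t : ℕ → ℝ) :
    LipschitzWith 1 ⇑(clampedSum x t) := by
  refine LipschitzWith.of_dist_le_mul fun p q => ?_
  have hs := summable_clampReal_smul hx hw.summable t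
  have hp := fun p => (ContinuousMap.evalCLM ℝ p).hasSum hs.hasSum
  have h := (hp p).sub (hp q)
  have hb : HasSum (fun k => 2 * w k * dist p q) (1 * dist p q) := by
    simpa using (hw.mul_left 2).mul_right (dist p q)
  have := tsum_of_norm_bounded hb (f := fun k => clampReal (t k) * x k p - clampReal (t k) * x k q)
    fun k => by
      rw [← mul_sub, norm_mul, Real.norm_eq_abs, mul_assoc]
      exact mul_le_mul (abs_clampReal_le _) (by simpa [Real.dist_eq] using (hxl k).dist_le_mul p q)
        (norm_nonneg _) (by norm_num)
  have h2 : ∑' k, (clampReal (t k) * x k p - clampReal (t k) * x k q) =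
      clampedSum x t p - clampedSum x t q := h.tsum_eq
  rw [h2] at this
  simpa [Real.dist_eq] using this

universe u

/-- Let `R` be a compact metric space. Then there is a compact subset `K` of
`C(R, ℝ)` (with the sup norm) such that whenever `K` embeds isometrically into a real Banach
space `Y`, then `C(R, ℝ)` is linearly isometric to a subspace of `Y`. -/
theorem stmt1 (R : Type*) [MetricSpace R] [CompactSpace R] :
    ∃ K : Set C(R, ℝ), IsCompact K ∧
      ∀ (Y : Type u) [NormedAddCommGroup Y] [NormedSpace ℝ Y] [CompleteSpace Y],
        (∃ j : K → Y, Isometry j) → Nonempty (C(R, ℝ) →ₗᵢ[ℝ] Y) := by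
  refine ⟨{g : C(R, ℝ) | LipschitzWith 1 g ∧ ‖g‖ ≤ 1 + Metric.diam (univ : Set R)},
    isCompact_setOf_lipschitzWith_norm_le 1 _, ?_⟩
  rintro Y _ _ _ ⟨j, hj⟩
  set w : ℕ → ℝ≥0 := fun k => 1 / 4 * (1 / 2) ^ k with hwdef
  have hw : HasSum (fun k => (w k : ℝ)) (1 / 2) := by
    have := hasSum_geometric_two.mul_left (1 / 4 : ℝ)
    norm_num [hwdef] at this ⊢
    exact this
  have hw1 : ∀ k, (w k : ℝ) ≤ 1 := fun k =>
    (le_hasSum hw k fun _ _ => NNReal.coe_nonneg _).trans (by norm_num)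
  obtain ⟨x, hx, hxl, hxd⟩ := exists_seq_small_lipschitz (R := R) (w := w)
    fun k => by positivity
  have hmem : ∀ t, clampedSum x t ∈
      {g : C(R, ℝ) | LipschitzWith 1 g ∧ ‖g‖ ≤ 1 + Metric.diam (univ : Set R)} := fun t =>
    ⟨lipschitzWith_clampedSum hx hxl hw t,
      (norm_clampedSum_le hx hw t).trans (by linarith [Metric.diam_nonneg (s := (univ : Set R))])⟩
  set F : (ℕ → ℝ) → Y := fun t => j ⟨clampedSum x t, hmem t⟩ with hFdef
  have hFsub : ∀ t u, ‖F t - F u‖ = ‖clampedSum x t - clampedSum x u‖ := by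
    intro t u
    rw [← dist_eq_norm, hj.dist_eq, Subtype.dist_eq, dist_eq_norm]
  have hF : SepLipschitz F := by
    refine ⟨hj.continuous.comp ((continuous_clampedSum hx hw.summable).subtype_mk hmem),
      ⟨‖F 0‖ + 2, fun t => ?_⟩, fun t n r s => ?_⟩
    · have h1 := norm_sub_le (clampedSum x t) (clampedSum x 0)
      rw [← hFsub] at h1
      linarith [norm_le_norm_add_norm_sub' (F t) (F 0), norm_clampedSum_le hx hw t,
        norm_clampedSum_le hx hw (0 : ℕ → ℝ)]
    · rw [hFsub, clampedSum_update_sub hx hw.summable, norm_smul, ← mul_one |r - s|]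
      exact mul_le_mul (abs_clampReal_sub_le r s) ((hx n).trans (hw1 n)) (norm_nonneg _)
        (abs_nonneg _)
  have hle := hF.norm_sum_smul_meanIncrement_le (x := x) (by
    intro t a S ht ha
    rw [hFsub, clampedSum_sub hx hw.summable S]
    · refine (congrArg norm (Finset.sum_congr rfl fun k hk => ?_)).le
      have h1 := abs_le.1 (ha k hk)
      have h2 := ht k
      rw [clampReal_of_mem (r := t k) ⟨by linarith [h2.1], by linarith [h2.2]⟩]
      rw [Pi.add_apply, Finset.piecewise_eq_of_mem _ _ _ hk,
        clampReal_of_mem ⟨by linarith [h2.1, h1.1], by linarith [h2.2, h1.2]⟩]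
      congr 1; ring
    · intro k hk
      simp [hk])
  refine nonempty_linearIsometry_of_norm_linearCombination (D := meanIncrement F) hxd
    fun a => le_antisymm (hle a a.support) ?_
  rw [ContinuousMap.norm_le _ (norm_nonneg _)]
  intro p
  obtain ⟨y, hy1, c, hy⟩ := exists_dual_apply_sub_eq rfl hj p
  have hyF : ∀ t, y (F t) = clampedSum x t p + c := fun t =>
    hy ⟨clampedSum x t, hmem t⟩ (norm_clampedSum_le hx hw t)
  have hyD : ∀ n, y (meanIncrement F n) = x n p := by
    intro n
    refine hF.apply_meanIncrement y n fun t => ?_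
    have h1 := clampedSum_update_sub hx hw.summable t n 1 0
    rw [clampReal_of_mem (by norm_num), clampReal_of_mem (by norm_num), sub_zero, one_smul] at h1
    rw [hyF, hyF, ← h1]
    simp
  have hya : y (Finsupp.linearCombination ℝ (meanIncrement F) a) =
      Finsupp.linearCombination ℝ x a p := by
    simp [Finsupp.linearCombination_apply, Finsupp.sum, hyD]
  rw [← hya]
  exact (y.le_of_opNorm_le hy1 _).trans (by simp)
end

section
/- Let K₀ = {f ∈ C([0,1]) : ‖f‖∞ ≤ 1 and f is 1-Lipschitz}. If a real Banach space Y contains an isometric copy of K₀ (i.e., there exists a distance-preserving map from K₀ into Y), then every separable metric space admits a distance-preserving map into Y. -/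
open MeasureTheory Filter Topology

theorem exists_isometry_of_denseRange {α X Y : Type*} [MetricSpace X] [MetricSpace Y]
    [CompleteSpace Y] {u : α → X} (hu : DenseRange u) (G : α → Y)
    (hG : ∀ a b, dist (G a) (G b) = dist (u a) (u b)) : ∃ j : X → Y, Isometry j := by
  have hne : ∀ x, (comap u (𝓝 x)).NeBot := fun x ↦ comap_neBot fun s hs ↦ by
    obtain ⟨_, ha, a, rfl⟩ := mem_closure_iff_nhds.1 (hu x) s hs
    exact ⟨a, ha⟩
  have hlim : ∀ x, ∃ y, Tendsto G (comap u (𝓝 x)) (𝓝 y) := by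
    intro x
    have := hne x
    apply cauchy_map_iff_exists_tendsto.1
    rw [Metric.cauchy_iff]
    refine ⟨inferInstance, fun ε hε ↦ ⟨G '' (u ⁻¹' Metric.ball x (ε / 2)), ?_, ?_⟩⟩
    · exact image_mem_map (preimage_mem_comap (Metric.ball_mem_nhds x (half_pos hε)))
    · rintro _ ⟨a, ha, rfl⟩ _ ⟨b, hb, rfl⟩
      rw [hG]
      have := dist_triangle_right (u a) (u b) x
      simp only [Set.mem_preimage, Metric.mem_ball] at ha hb
      linarith
  choose j hj using hlim
  refine ⟨j, Isometry.of_dist_eq fun x y ↦ ?_⟩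
  have := hne x
  have := hne y
  have h₁ : Tendsto (fun p : α × α ↦ dist (G p.1) (G p.2)) (comap u (𝓝 x) ×ˢ comap u (𝓝 y))
      (𝓝 (dist (j x) (j y))) :=
    ((hj x).comp tendsto_fst).dist ((hj y).comp tendsto_snd)
  have h₂ : Tendsto (fun p : α × α ↦ dist (u p.1) (u p.2)) (comap u (𝓝 x) ×ˢ comap u (𝓝 y))
      (𝓝 (dist x y)) :=
    (tendsto_comap.comp tendsto_fst).dist (tendsto_comap.comp tendsto_snd)
  simp only [hG] at h₁
  exact tendsto_nhds_unique h₁ h₂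

/-- The uniform probability measure on the Hilbert cube `[0,1]^ℕ`, as a measure on `ℕ → ℝ`. -/
noncomputable def cubeMeasure : Measure (ℕ → ℝ) :=
  Measure.infinitePi fun _ ↦ volume.restrict (Set.Ioc (0 : ℝ) 1)

instance : IsProbabilityMeasure (volume.restrict (Set.Ioc (0 : ℝ) 1)) := ⟨by simp⟩

instance : IsProbabilityMeasure cubeMeasure := by unfold cubeMeasure; infer_instance

theorem ae_cubeMeasure_of_ae {p : ℕ → ℝ → Prop}
    (hp : ∀ k, ∀ᵐ u ∂(volume.restrict (Set.Ioc (0 : ℝ) 1)), p k u) :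
    ∀ᵐ t ∂cubeMeasure, ∀ k, p k (t k) :=
  ae_all_iff.2 fun k ↦ (measurePreserving_eval_infinitePi
    (fun _ : ℕ ↦ volume.restrict (Set.Ioc (0 : ℝ) 1)) k).quasiMeasurePreserving.ae (hp k)

theorem ae_cubeMeasure_mem_Ioc : ∀ᵐ t ∂cubeMeasure, ∀ k, t k ∈ Set.Ioc (0 : ℝ) 1 :=
  ae_cubeMeasure_of_ae (p := fun _ u ↦ u ∈ Set.Ioc (0 : ℝ) 1)
    fun _ ↦ ae_restrict_mem measurableSet_Ioc

theorem ae_cubeMeasure_ne (c : ℕ → ℝ) : ∀ᵐ t ∂cubeMeasure, ∀ k, t k ≠ c k :=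
  ae_cubeMeasure_of_ae (p := fun k u ↦ u ≠ c k)
    fun k ↦ ae_restrict_of_ae (Measure.ae_ne volume (c k))

theorem measurable_decide_lt (s : ℕ → ℝ) :
    Measurable fun t : ℕ → ℝ ↦ fun k ↦ decide (t k < s k) := by
  refine measurable_pi_lambda _ fun k ↦ measurable_to_bool ?_
  simpa [Set.preimage] using measurableSet_lt (measurable_pi_apply k) measurable_const

theorem integrable_comp_decide_lt (F : C(ℕ → Bool, ℝ)) (s : ℕ → ℝ) :
    Integrable (fun t ↦ F fun k ↦ decide (t k < s k)) cubeMeasure :=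
  .of_bound (F.continuous.measurable.comp (measurable_decide_lt s)).aestronglyMeasurable ‖F‖
    (.of_forall fun _ ↦ F.norm_coe_le_norm _)

theorem continuous_integral_decide_lt (F : C(ℕ → Bool, ℝ)) :
    Continuous fun s : ℕ → ℝ ↦ ∫ t, F (fun k ↦ decide (t k < s k)) ∂cubeMeasure := by
  refine continuous_iff_continuousAt.2 fun s₀ ↦ continuousAt_of_dominated (bound := fun _ ↦ ‖F‖)
    (.of_forall fun s ↦ (integrable_comp_decide_lt F s).aestronglyMeasurable)
    (.of_forall fun _ ↦ .of_forall fun _ ↦ F.norm_coe_le_norm _) (integrable_const _) ?_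
  filter_upwards [ae_cubeMeasure_ne s₀] with t ht
  refine F.continuous.continuousAt.comp (continuousAt_pi.2 fun k ↦ ?_)
  refine tendsto_nhds_of_eventually_eq ?_
  have hk : Tendsto (fun s : ℕ → ℝ ↦ s k) (𝓝 s₀) (𝓝 (s₀ k)) := (continuous_apply k).tendsto s₀
  rcases (ht k).lt_or_gt with h | h
  · filter_upwards [hk.eventually_const_lt h] with s hs
    simp [h, hs]
  · filter_upwards [hk.eventually_lt_const h] with s hs
    simp [h.le.not_gt, hs.le.not_gt]

/-- `C({0,1}^ℕ)` embeds isometrically into `C([0,1])`. -/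
theorem exists_isometry_cantor_to_interval :
    ∃ E : C(ℕ → Bool, ℝ) → C(Set.Icc (0 : ℝ) 1, ℝ), Isometry E := by
  let ι : (ℕ → Bool) → Set.Icc (0 : ℝ) 1 := fun ω ↦
    ⟨cantorSetHomeomorphNatToBool.symm ω, cantorSet_subset_unitInterval (Subtype.mem _)⟩
  have hι : IsClosedEmbedding ι := by
    refine Continuous.isClosedEmbedding (by fun_prop) fun a b hab ↦ ?_
    exact cantorSetHomeomorphNatToBool.symm.injective
      (Subtype.ext (by simpa [ι, Subtype.ext_iff] using hab))
  let b : C(ℕ → Bool, ℕ → ℝ) :=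
    ⟨fun ω k ↦ if ω k then 1 else 0, continuous_pi fun k ↦
      (continuous_of_discreteTopology (f := fun c : Bool ↦ if c then (1 : ℝ) else 0)).comp
        (continuous_apply k)⟩
  obtain ⟨e, he⟩ := b.exists_extension' hι
  let E : C(ℕ → Bool, ℝ) → C(Set.Icc (0 : ℝ) 1, ℝ) := fun F ↦
    ⟨fun x ↦ ∫ t, F (fun k ↦ decide (t k < e x k)) ∂cubeMeasure,
      (continuous_integral_decide_lt F).comp e.continuous⟩
  have hE : ∀ F ω, E F (ι ω) = F ω := by
    intro F ω
    have h : ∀ᵐ t ∂cubeMeasure, F (fun k ↦ decide (t k < e (ι ω) k)) = F ω := by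
      filter_upwards [ae_cubeMeasure_mem_Ioc, ae_cubeMeasure_ne fun _ ↦ 1] with t ht ht'
      congr 1
      funext k
      have hk : e (ι ω) k = if ω k then 1 else 0 := congrFun (congrFun he ω) k
      rw [hk]
      cases ω k
      · simpa using (ht k).1.le
      · simpa using lt_of_le_of_ne (ht k).2 (ht' k)
    calc E F (ι ω) = ∫ _, F ω ∂cubeMeasure := integral_congr_ae h
      _ = F ω := by simp
  refine ⟨E, Isometry.of_dist_eq fun F G ↦ le_antisymm ?_ ?_⟩
  · refine (ContinuousMap.dist_le dist_nonneg).2 fun x ↦ ?_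
    have : E F x - E G x = ∫ t, (F (fun k ↦ decide (t k < e x k)) -
        G (fun k ↦ decide (t k < e x k))) ∂cubeMeasure :=
      (integral_sub (integrable_comp_decide_lt F _) (integrable_comp_decide_lt G _)).symm
    rw [Real.dist_eq, this, ← Real.norm_eq_abs]
    refine (norm_integral_le_of_norm_le_const (.of_forall fun t ↦ ?_)).trans_eq
      (by simp [Measure.real] : dist F G * cubeMeasure.real Set.univ = dist F G)
    rw [← dist_eq_norm]
    exact ContinuousMap.dist_apply_le_dist _
  · refine (ContinuousMap.dist_le dist_nonneg).2 fun ω ↦ ?_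
    rw [← hE F ω, ← hE G ω]
    exact ContinuousMap.dist_apply_le_dist _

/-- Every separable metric space embeds isometrically into `C({0,1}^ℕ)`. -/
theorem exists_isometry_to_cantor (M : Type*) [MetricSpace M] [TopologicalSpace.SeparableSpace M]
    [Nonempty M] : ∃ j : M → C(ℕ → Bool, ℝ), Isometry j := by
  let m := TopologicalSpace.denseSeq M
  let K : Set (ℕ → ℝ) := {g | (∀ i j, |g i - g j| ≤ dist (m i) (m j)) ∧ g 0 = 0}
  have hK : IsCompact K := by
    have hKc : IsClosed K := by
      have : K = (⋂ i, ⋂ j, {g | |g i - g j| ≤ dist (m i) (m j)}) ∩ {g | g 0 = 0} := by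
        ext g
        simp [K]
      rw [this]
      exact (isClosed_iInter fun i ↦ isClosed_iInter fun j ↦
        isClosed_le (by fun_prop) continuous_const).inter
          (isClosed_eq (continuous_apply 0) continuous_const)
    have hbox := isCompact_univ_pi fun i ↦
      (isCompact_Icc : IsCompact (Set.Icc (-dist (m i) (m 0)) (dist (m i) (m 0))))
    refine hbox.of_isClosed_subset hKc ?_
    rintro g ⟨hg, hg0⟩ i -
    have := hg i 0
    rwa [hg0, sub_zero, abs_le] at this
  have hmem : ∀ i, (fun k ↦ dist (m k) (m i) - dist (m 0) (m i)) ∈ K := fun i ↦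
    ⟨fun a b ↦ by simpa using abs_dist_sub_le (m a) (m b) (m i), by simp⟩
  have : CompactSpace K := isCompact_iff_compactSpace.1 hK
  have : Nonempty K := ⟨⟨_, hmem 0⟩⟩
  let _ : MetricSpace K := TopologicalSpace.metrizableSpaceMetric K
  obtain ⟨σ, hσ, hσs⟩ := exists_nat_bool_continuous_surjective_of_compact K
  let G : ℕ → C(ℕ → Bool, ℝ) := fun i ↦
    ⟨fun ω ↦ (σ ω : ℕ → ℝ) i, (continuous_apply i).comp (continuous_subtype_val.comp hσ)⟩
  refine exists_isometry_of_denseRange (TopologicalSpace.denseRange_denseSeq M) G fun i j ↦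
    le_antisymm ?_ ?_
  · exact (ContinuousMap.dist_le dist_nonneg).2 fun ω ↦ (σ ω).2.1 i j
  · obtain ⟨ω, hω⟩ := hσs ⟨_, hmem j⟩
    have h : dist (G i ω) (G j ω) = dist (m i) (m j) := by
      simp [G, hω]
    exact h ▸ ContinuousMap.dist_apply_le_dist ω

section CubeAverage

variable {Y : Type*} [NormedAddCommGroup Y]

theorem measurePreserving_update_cubeMeasure (n : ℕ) :
    MeasurePreserving (fun p : (ℕ → ℝ) × ℝ ↦ Function.update p.1 n p.2)
      (cubeMeasure.prod (volume.restrict (Set.Ioc (0 : ℝ) 1))) cubeMeasure := by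
  have hm : Measurable fun p : (ℕ → ℝ) × ℝ ↦ Function.update p.1 n p.2 := by
    refine measurable_pi_lambda _ fun k ↦ ?_
    rcases eq_or_ne k n with rfl | h
    · simpa using measurable_snd
    · simpa [h] using measurable_fst.eval
  refine ⟨hm, Measure.eq_infinitePi _ fun s A hA ↦ ?_⟩
  rw [Measure.map_apply hm (MeasurableSet.pi s.countable_toSet fun i _ ↦ hA i)]
  have hpre : (fun p : (ℕ → ℝ) × ℝ ↦ Function.update p.1 n p.2) ⁻¹' (s : Set ℕ).pi A =
      ((s.erase n : Finset ℕ) : Set ℕ).pi A ×ˢ (if n ∈ s then A n else Set.univ) := by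
    ext ⟨t, u⟩
    simp only [Set.mem_preimage, Set.mem_pi, Finset.mem_coe, Set.mem_prod, Finset.mem_erase]
    constructor
    · refine fun h ↦ ⟨fun i hi ↦ by simpa [hi.1] using h i hi.2, ?_⟩
      split_ifs with hn
      · simpa using h n hn
      · trivial
    · rintro ⟨h, hn⟩ i hi
      rcases eq_or_ne i n with rfl | hin
      · simpa [hi] using hn
      · simpa [hin] using h i ⟨hin, hi⟩
  rw [hpre, Measure.prod_prod, cubeMeasure, Measure.infinitePi_pi _ fun i _ ↦ hA i]
  split_ifs with hn
  · rw [Finset.prod_erase_mul _ _ hn]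
  · rw [measure_univ, mul_one, Finset.erase_eq_of_notMem hn]

/-- Bounded continuous maps on `ℕ → ℝ` that are Lipschitz in each coordinate. -/
structure CoordLipschitz (c : ℕ → ℝ) (f : (ℕ → ℝ) → Y) : Prop where
  continuous : Continuous f
  bounded : ∃ B, ∀ t, ‖f t‖ ≤ B
  norm_add_single_sub_le : ∀ t n b, ‖f (t + Pi.single n b) - f t‖ ≤ c n * |b|

namespace CoordLipschitz

variable {c : ℕ → ℝ} {f : (ℕ → ℝ) → Y}

theorem comp_add (hf : CoordLipschitz c f) (w : ℕ → ℝ) :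
    CoordLipschitz c fun t ↦ f (t + w) where
  continuous := hf.continuous.comp (by fun_prop)
  bounded := hf.bounded.imp fun _ h t ↦ h _
  norm_add_single_sub_le t n b := by
    rw [add_right_comm]
    exact hf.norm_add_single_sub_le _ n b

theorem exists_norm_add_smul_sub_le (hf : CoordLipschitz c f) (a : ℕ →₀ ℝ) :
    ∃ D, ∀ (ε : ℝ) t, ‖f (t + ε • ⇑a) - f t‖ ≤ D * |ε| := by
  induction a using Finsupp.induction with
  | zero => exact ⟨0, by simp⟩
  | single_add n b a _ _ ih =>
    obtain ⟨D, hD⟩ := ih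
    refine ⟨c n * |b| + D, fun ε t ↦ ?_⟩
    have h : t + ε • ⇑(Finsupp.single n b + a) = t + ε • ⇑a + Pi.single n (ε * b) := by
      rw [Finsupp.coe_add, smul_add, Finsupp.single_eq_pi_single, ← Pi.single_smul, smul_eq_mul]
      abel
    have h₁ := hf.norm_add_single_sub_le (t + ε • ⇑a) n (ε * b)
    rw [abs_mul] at h₁
    rw [h]
    calc _ ≤ _ := norm_sub_le_norm_sub_add_norm_sub _ (f (t + ε • ⇑a)) _
      _ ≤ c n * (|ε| * |b|) + D * |ε| := add_le_add h₁ (hD ε t)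
      _ = _ := by ring

theorem integrable_comp (hf : CoordLipschitz c f) {g : (ℕ → ℝ) → ℕ → ℝ} (hg : Continuous g) :
    Integrable (fun t ↦ f (g t)) cubeMeasure :=
  let ⟨B, hB⟩ := hf.bounded
  .of_bound (hf.continuous.comp hg).aestronglyMeasurable B (.of_forall fun _ ↦ hB _)

theorem continuous_update (n : ℕ) (u : ℝ) : Continuous fun t : ℕ → ℝ ↦ Function.update t n u :=
  continuous_id.update n continuous_const

theorem integrable (hf : CoordLipschitz c f) : Integrable f cubeMeasure :=
  hf.integrable_comp continuous_id

theorem integrable_update_sub_update (hf : CoordLipschitz c f) (n : ℕ) :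
    Integrable (fun t ↦ f (Function.update t n 1) - f (Function.update t n 0)) cubeMeasure :=
  (hf.integrable_comp (continuous_update n 1)).sub (hf.integrable_comp (continuous_update n 0))

variable [NormedSpace ℝ Y]

/-- The average over the Hilbert cube of the increments of `f` between opposite faces. -/
noncomputable def _root_.cubeDiff (f : (ℕ → ℝ) → Y) (n : ℕ) : Y :=
  ∫ t, (f (Function.update t n 1) - f (Function.update t n 0)) ∂cubeMeasure

theorem norm_cubeDiff_comp_add_sub_le (hf : CoordLipschitz c f) (w : ℕ → ℝ) {D : ℝ}
    (hD : ∀ t, ‖f (t + w) - f t‖ ≤ D) (n : ℕ) :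
    ‖cubeDiff (fun t ↦ f (t + w)) n - cubeDiff f n‖ ≤ 2 * D := by
  rw [cubeDiff, cubeDiff, ← integral_sub ((hf.comp_add w).integrable_update_sub_update n)
    (hf.integrable_update_sub_update n)]
  refine (norm_integral_le_of_norm_le_const (.of_forall fun t ↦ ?_)).trans_eq
    (by simp [Measure.real] : 2 * D * cubeMeasure.real Set.univ = 2 * D)
  rw [sub_sub_sub_comm, two_mul]
  exact (norm_sub_le _ _).trans (add_le_add (hD _) (hD _))

theorem integral_eq_integral_update (hf : CoordLipschitz c f) (n : ℕ) :
    ∫ t, f t ∂cubeMeasure =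
      ∫ t, (∫ u in (0 : ℝ)..1, f (Function.update t n u)) ∂cubeMeasure ∧
    Integrable (fun t ↦ ∫ u in (0 : ℝ)..1, f (Function.update t n u)) cubeMeasure := by
  have hmp := measurePreserving_update_cubeMeasure n
  have hi : Integrable (fun p : (ℕ → ℝ) × ℝ ↦ f (Function.update p.1 n p.2))
      (cubeMeasure.prod (volume.restrict (Set.Ioc (0 : ℝ) 1))) :=
    hmp.integrable_comp_of_integrable (hf.integrable_comp continuous_id)
  simp_rw [intervalIntegral.integral_of_le zero_le_one]
  refine ⟨?_, hi.integral_prod_left⟩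
  rw [← integral_prod _ hi]
  conv_lhs => rw [← hmp.map_eq]
  exact integral_map hmp.aemeasurable hf.continuous.aestronglyMeasurable

variable [CompleteSpace Y]

theorem _root_.norm_integral_shift_sub_le {h : ℝ → Y} {C : ℝ} (hc : Continuous h)
    (hC : ∀ u v, ‖h u - h v‖ ≤ C * |u - v|) (η : ℝ) :
    ‖(∫ u in (0 : ℝ)..1, h (u + η)) - (∫ u in (0 : ℝ)..1, h u) - η • (h 1 - h 0)‖
      ≤ 2 * C * η ^ 2 := by
  have hi : ∀ a b, IntervalIntegrable h volume a b := fun a b ↦ hc.intervalIntegrable a b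
  have hC0 : 0 ≤ C := by simpa using (norm_nonneg _).trans (hC 1 0)
  have key : ∀ a, ‖(∫ u in a..(a + η), h u) - η • h a‖ ≤ C * η ^ 2 := by
    intro a
    have : (∫ u in a..(a + η), h u) - η • h a = ∫ u in a..(a + η), (h u - h a) := by
      rw [intervalIntegral.integral_sub (hi _ _) (by simp)]
      simp
    rw [this]
    refine (intervalIntegral.norm_integral_le_of_norm_le_const (C := C * |η|)
      fun u hu ↦ (hC u a).trans ?_).trans_eq ?_
    · have := Set.abs_sub_left_of_mem_uIcc (Set.uIoc_subset_uIcc hu)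
      rw [add_sub_cancel_left] at this
      gcongr
    · rw [add_sub_cancel_left, mul_assoc, ← sq, sq_abs]
  have hsplit : (∫ u in (0 : ℝ)..1, h (u + η)) - (∫ u in (0 : ℝ)..1, h u) =
      (∫ u in (1 : ℝ)..(1 + η), h u) - ∫ u in (0 : ℝ)..(0 + η), h u := by
    rw [intervalIntegral.integral_comp_add_right]
    have h₁ := intervalIntegral.integral_add_adjacent_intervals (hi 0 (0 + η)) (hi (0 + η) (1 + η))
    have h₂ := intervalIntegral.integral_add_adjacent_intervals (hi 0 1) (hi 1 (1 + η))
    rw [sub_eq_sub_iff_add_eq_add, add_comm, h₁, add_comm (∫ u in (1 : ℝ)..(1 + η), h u), h₂]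
  calc _ = ‖((∫ u in (1 : ℝ)..(1 + η), h u) - η • h 1) -
        ((∫ u in (0 : ℝ)..(0 + η), h u) - η • h 0)‖ := by
        rw [hsplit, smul_sub, sub_sub_sub_comm]
    _ ≤ C * η ^ 2 + C * η ^ 2 := (norm_sub_le _ _).trans (add_le_add (key 1) (key 0))
    _ = _ := by ring

theorem norm_integral_add_single_sub_le (hf : CoordLipschitz c f) (n : ℕ) (η : ℝ) :
    ‖(∫ t, f (t + Pi.single n η) ∂cubeMeasure) - (∫ t, f t ∂cubeMeasure) - η • cubeDiff f n‖
      ≤ 2 * c n * η ^ 2 := by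
  obtain ⟨h₁, hi₁⟩ := (hf.comp_add (Pi.single n η)).integral_eq_integral_update n
  obtain ⟨h₂, hi₂⟩ := hf.integral_eq_integral_update n
  have hupd : ∀ (t : ℕ → ℝ) u v,
      Function.update t n u + Pi.single n v = Function.update t n (u + v) := by
    intro t u v
    ext k
    rcases eq_or_ne k n with rfl | h <;> simp [*]
  simp_rw [hupd] at h₁ hi₁
  rw [h₁, h₂, cubeDiff, ← integral_sub hi₁ hi₂, ← integral_smul,
    ← integral_sub (by exact hi₁.sub hi₂)
      (by exact (hf.integrable_update_sub_update n).smul η)]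
  refine (norm_integral_le_of_norm_le_const (.of_forall fun t ↦ ?_)).trans_eq
    (by simp [Measure.real] : 2 * c n * η ^ 2 * cubeMeasure.real Set.univ = 2 * c n * η ^ 2)
  refine norm_integral_shift_sub_le (h := fun u ↦ f (Function.update t n u))
    (hf.continuous.comp (continuous_const.update n continuous_id)) (fun u v ↦ ?_) η
  have := hf.norm_add_single_sub_le (Function.update t n v) n (u - v)
  rwa [hupd, add_sub_cancel] at this

theorem map_cubeDiff_eq (hf : CoordLipschitz c f) (φ : StrongDual ℝ Y) (n : ℕ) {r : ℝ}
    (h : ∀ t, φ (f (Function.update t n 1) - f (Function.update t n 0)) = r) :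
    φ (cubeDiff f n) = r := by
  rw [cubeDiff, ← φ.integral_comp_comm (hf.integrable_update_sub_update n)]
  simp_rw [h]
  simp

theorem exists_norm_integral_add_smul_sub_le (hf : CoordLipschitz c f) (a : ℕ →₀ ℝ) :
    ∃ C, ∀ ε : ℝ, ‖(∫ t, f (t + ε • ⇑a) ∂cubeMeasure) - (∫ t, f t ∂cubeMeasure) -
      ε • Finsupp.linearCombination ℝ (cubeDiff f) a‖ ≤ C * ε ^ 2 := by
  induction a using Finsupp.induction with
  | zero => exact ⟨0, by simp⟩
  | single_add n b a _ _ ih =>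
    obtain ⟨C, hC⟩ := ih
    obtain ⟨D, hD⟩ := hf.exists_norm_add_smul_sub_le a
    refine ⟨2 * c n * b ^ 2 + C + 2 * D * |b|, fun ε ↦ ?_⟩
    have h : ∀ t, t + ε • ⇑(Finsupp.single n b + a) = t + Pi.single n (ε * b) + ε • ⇑a := by
      intro t
      rw [Finsupp.coe_add, smul_add, Finsupp.single_eq_pi_single, ← Pi.single_smul, smul_eq_mul]
      abel
    simp_rw [h]
    have h₁ := (hf.comp_add (ε • ⇑a)).norm_integral_add_single_sub_le n (ε * b)
    have h₂ := hC ε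
    have h₃ := hf.norm_cubeDiff_comp_add_sub_le (ε • ⇑a) (hD ε) n
    set g : (ℕ → ℝ) → Y := fun t ↦ f (t + ε • ⇑a)
    have h₄ : ‖(ε * b) • (cubeDiff g n - cubeDiff f n)‖ ≤ 2 * D * |b| * ε ^ 2 := by
      rw [norm_smul, Real.norm_eq_abs, abs_mul]
      calc _ ≤ |ε| * |b| * (2 * (D * |ε|)) := by gcongr
        _ = 2 * D * |b| * |ε| ^ 2 := by ring
        _ = _ := by rw [sq_abs]
    rw [map_add, Finsupp.linearCombination_single]
    calc _ = ‖((∫ t, g (t + Pi.single n (ε * b)) ∂cubeMeasure) - (∫ t, g t ∂cubeMeasure) -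
          (ε * b) • cubeDiff g n) + ((∫ t, g t ∂cubeMeasure) - (∫ t, f t ∂cubeMeasure) -
          ε • Finsupp.linearCombination ℝ (cubeDiff f) a) +
          (ε * b) • (cubeDiff g n - cubeDiff f n)‖ := by
          congr 1
          module
      _ ≤ 2 * c n * (ε * b) ^ 2 + C * ε ^ 2 + 2 * D * |b| * ε ^ 2 :=
        norm_add₃_le.trans (add_le_add_three h₁ h₂ h₄)
      _ = _ := by ring

theorem norm_linearCombination_cubeDiff_le (hf : CoordLipschitz c f) {a : ℕ →₀ ℝ} {L : ℝ}
    (hL : ∀ᶠ ε in 𝓝[>] (0 : ℝ), ∀ᵐ t ∂cubeMeasure, ‖f (t + ε • ⇑a) - f t‖ ≤ ε * L) :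
    ‖Finsupp.linearCombination ℝ (cubeDiff f) a‖ ≤ L := by
  obtain ⟨C, hC⟩ := hf.exists_norm_integral_add_smul_sub_le a
  have hlim : Tendsto (fun ε : ℝ ↦ L + C * ε) (𝓝[>] 0) (𝓝 L) := by
    have : Continuous fun ε : ℝ ↦ L + C * ε := by fun_prop
    simpa using (this.tendsto 0).mono_left nhdsWithin_le_nhds
  refine ge_of_tendsto hlim ?_
  filter_upwards [hL, self_mem_nhdsWithin] with ε hε hpos
  rw [Set.mem_Ioi] at hpos
  have h₁ : ‖(∫ t, f (t + ε • ⇑a) ∂cubeMeasure) - ∫ t, f t ∂cubeMeasure‖ ≤ ε * L := by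
    rw [← integral_sub (hf.comp_add _).integrable hf.integrable]
    exact (norm_integral_le_of_norm_le_const hε).trans_eq
      (by simp [Measure.real] : ε * L * cubeMeasure.real Set.univ = ε * L)
  have h₂ := (norm_sub_norm_le _ _).trans ((norm_sub_rev _ _).trans_le (hC ε))
  rw [norm_smul, Real.norm_of_nonneg hpos.le] at h₂
  refine le_of_mul_le_mul_left ?_ hpos
  linarith

end CoordLipschitz

end CubeAverage

section CubeMap

/-- The restriction to `[-1, 2]` of a real number. -/
noncomputable def clamp (u : ℝ) : ℝ := max (-1) (min u 2)

@[fun_prop]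
theorem continuous_clamp : Continuous clamp := by unfold clamp; fun_prop

theorem abs_clamp_le (u : ℝ) : |clamp u| ≤ 2 := by
  unfold clamp
  grind

theorem abs_clamp_sub_clamp_le (u v : ℝ) : |clamp u - clamp v| ≤ |u - v| := by
  unfold clamp
  grind

theorem clamp_of_mem {u : ℝ} (h₁ : -1 ≤ u) (h₂ : u ≤ 2) : clamp u = u := by
  simp [clamp, h₁, h₂]

/-- The continuous map `(t k) ↦ ∑ k, t k • x k`, with coordinates truncated to `[-1, 2]`. -/
noncomputable def cubeMap {E : Type*} [NormedAddCommGroup E] [NormedSpace ℝ E] (x : ℕ → E)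
    (t : ℕ → ℝ) : E := ∑' k, clamp (t k) • x k

theorem hasSum_half_pow_add_two : HasSum (fun k : ℕ ↦ (1 / 2 : ℝ) ^ (k + 2)) (1 / 2) := by
  have := (hasSum_geometric_of_lt_one (r := (1 / 2 : ℝ)) (by norm_num) (by norm_num)).mul_right
    ((1 / 2 : ℝ) ^ 2)
  simp_rw [← pow_add] at this
  convert! this using 1
  norm_num

theorem abs_clamp_mul_le {k : ℕ} {a D : ℝ} (u : ℝ) (ha : |a| ≤ (1 / 2) ^ (k + 3) * D) :
    |clamp u * a| ≤ (1 / 2) ^ (k + 2) * D := by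
  rw [abs_mul]
  calc _ ≤ 2 * ((1 / 2) ^ (k + 3) * D) :=
        mul_le_mul (abs_clamp_le u) ha (abs_nonneg _) (by norm_num)
    _ = _ := by ring

variable {E : Type*} [NormedAddCommGroup E] [NormedSpace ℝ E] {x : ℕ → E}

theorem norm_clamp_smul_le (hx : ∀ k, ‖x k‖ ≤ (1 / 2) ^ (k + 3)) (k : ℕ) (u : ℝ) :
    ‖clamp u • x k‖ ≤ (1 / 2) ^ (k + 2) := by
  simpa [norm_smul] using abs_clamp_mul_le u (a := ‖x k‖) (D := 1) (by simpa using hx k)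

theorem norm_cubeMap_le (hx : ∀ k, ‖x k‖ ≤ (1 / 2) ^ (k + 3)) (t : ℕ → ℝ) :
    ‖cubeMap x t‖ ≤ 1 / 2 :=
  tsum_of_norm_bounded hasSum_half_pow_add_two fun k ↦ norm_clamp_smul_le hx k (t k)

variable [CompleteSpace E]

theorem summable_clamp_smul (hx : ∀ k, ‖x k‖ ≤ (1 / 2) ^ (k + 3)) (t : ℕ → ℝ) :
    Summable fun k ↦ clamp (t k) • x k :=
  hasSum_half_pow_add_two.summable.of_norm_bounded fun k ↦ norm_clamp_smul_le hx k (t k)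

theorem continuous_cubeMap (hx : ∀ k, ‖x k‖ ≤ (1 / 2) ^ (k + 3)) : Continuous (cubeMap x) :=
  continuous_tsum (fun k ↦ by fun_prop) hasSum_half_pow_add_two.summable
    fun k t ↦ norm_clamp_smul_le hx k (t k)

theorem cubeMap_sub_eq (hx : ∀ k, ‖x k‖ ≤ (1 / 2) ^ (k + 3)) {t t' : ℕ → ℝ} {a : ℕ →₀ ℝ}
    (h : ∀ k, clamp (t k) - clamp (t' k) = a k) :
    cubeMap x t - cubeMap x t' = Finsupp.linearCombination ℝ x a := by
  rw [cubeMap, cubeMap, ← (summable_clamp_smul hx t).tsum_sub (summable_clamp_smul hx t')]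
  simp_rw [← sub_smul, h]
  rw [Finsupp.linearCombination_apply, Finsupp.sum]
  exact tsum_eq_sum fun k hk ↦ by simp [Finsupp.notMem_support_iff.1 hk]

theorem norm_cubeMap_add_single_sub_le (hx : ∀ k, ‖x k‖ ≤ (1 / 2) ^ (k + 3)) (t : ℕ → ℝ) (n : ℕ)
    (b : ℝ) : ‖cubeMap x (t + Pi.single n b) - cubeMap x t‖ ≤ ‖x n‖ * |b| := by
  rw [cubeMap_sub_eq hx (a := Finsupp.single n (clamp (t n + b) - clamp (t n))),
    Finsupp.linearCombination_single, norm_smul, mul_comm, Real.norm_eq_abs]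
  · refine mul_le_mul_of_nonneg_left ?_ (norm_nonneg _)
    simpa using abs_clamp_sub_clamp_le (t n + b) (t n)
  · intro k
    rcases eq_or_ne k n with rfl | h <;> simp [*]

theorem cubeMap_update_sub (hx : ∀ k, ‖x k‖ ≤ (1 / 2) ^ (k + 3)) (t : ℕ → ℝ) (n : ℕ) :
    cubeMap x (Function.update t n 1) - cubeMap x (Function.update t n 0) = x n := by
  rw [cubeMap_sub_eq hx (a := Finsupp.single n 1), Finsupp.linearCombination_single, one_smul]
  intro k
  rcases eq_or_ne k n with rfl | h
  · simp [clamp_of_mem]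
  · simp [h]

theorem cubeMap_add_smul_sub (hx : ∀ k, ‖x k‖ ≤ (1 / 2) ^ (k + 3)) {t : ℕ → ℝ}
    (ht : ∀ k, t k ∈ Set.Ioc (0 : ℝ) 1) {a : ℕ →₀ ℝ} {ε : ℝ} (ha : ∀ k, |ε * a k| ≤ 1) :
    cubeMap x (t + ε • ⇑a) - cubeMap x t = ε • Finsupp.linearCombination ℝ x a := by
  rw [← map_smul]
  refine cubeMap_sub_eq hx fun k ↦ ?_
  have h₁ := abs_le.1 (ha k)
  have h₂ := ht k
  rw [clamp_of_mem (u := t k) (by linarith [h₂.1]) (by linarith [h₂.2]), clamp_of_mem]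
  · simp
  · simp only [Pi.add_apply, Pi.smul_apply, smul_eq_mul]
    linarith [h₂.1]
  · simp only [Pi.add_apply, Pi.smul_apply, smul_eq_mul]
    linarith [h₂.2]

theorem eventually_forall_abs_mul_le_one (a : ℕ →₀ ℝ) :
    ∀ᶠ ε in 𝓝[>] (0 : ℝ), ∀ k, |ε * a k| ≤ 1 := by
  have h : ∀ᶠ ε in 𝓝[>] (0 : ℝ), ∀ k ∈ a.support, |ε * a k| < 1 := by
    refine (Finset.eventually_all _).2 fun k _ ↦ ?_
    have : Continuous fun ε : ℝ ↦ |ε * a k| := by fun_prop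
    exact nhdsWithin_le_nhds (this.tendsto' 0 0 (by simp) |>.eventually_lt_const one_pos)
  filter_upwards [h] with ε hε k
  by_cases hk : k ∈ a.support
  · exact (hε k hk).le
  · simp [Finsupp.notMem_support_iff.1 hk]

end CubeMap

section Interval

local notation "I" => Set.Icc (0 : ℝ) 1

/-- The `1`-Lipschitz functions in the unit ball of `C([0,1])`. -/
abbrev unitLipschitz : Set C(I, ℝ) := {f | ‖f‖ ≤ 1 ∧ LipschitzWith 1 f}

theorem exists_dual_eq_eval {Y : Type*} [NormedAddCommGroup Y] [NormedSpace ℝ Y]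
    {j : unitLipschitz → Y} (hj : Isometry j) (s : I) :
    ∃ φ : StrongDual ℝ Y, ‖φ‖ ≤ 1 ∧ ∀ z z' : unitLipschitz,
      ‖z.1‖ ≤ 1 / 2 → LipschitzWith (1 / 2) z.1 → ‖z'.1‖ ≤ 1 / 2 → LipschitzWith (1 / 2) z'.1 →
        φ (j z - j z') = z.1 s - z'.1 s := by
  let p : C(I, ℝ) := ⟨fun r ↦ 1 - dist r s, by fun_prop⟩
  have hdist : ∀ r : I, dist r s ≤ 1 := fun r ↦ by
    simpa using! Real.dist_le_of_mem_Icc r.2 s.2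
  have hpl : LipschitzWith 1 p := LipschitzWith.of_dist_le_mul fun r r' ↦ by
    change |1 - dist r s - (1 - dist r' s)| ≤ _
    rw [sub_sub_sub_cancel_left]
    simpa [dist_comm r' r] using abs_dist_sub_le r' r s
  have hpn : ‖p‖ ≤ 1 := (ContinuousMap.norm_le _ zero_le_one).2 fun r ↦ by
    change |1 - dist r s| ≤ 1
    rw [abs_le]
    constructor <;> linarith [hdist r, dist_nonneg (x := r) (y := s)]
  let P : unitLipschitz := ⟨p, hpn, hpl⟩
  let N : unitLipschitz := ⟨-p, by rwa [norm_neg], hpl.neg⟩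
  obtain ⟨φ, hφ, hφP⟩ := exists_dual_vector'' ℝ (j P - j N)
  have hφle : ∀ a b, φ (j a) - φ (j b) ≤ dist a b := fun a b ↦ by
    rw [← map_sub, ← hj.dist_eq, dist_eq_norm]
    exact (le_abs_self _).trans ((φ.le_of_opNorm_le hφ _).trans_eq (one_mul _))
  have hPN : 2 ≤ φ (j P) - φ (j N) := by
    rw [← map_sub, hφP, ← dist_eq_norm, hj.dist_eq]
    refine le_trans ?_ (ContinuousMap.dist_apply_le_dist (f := p) (g := -p) s)
    rw [Real.dist_eq]
    norm_num [p]
  have key : ∀ z : unitLipschitz, ‖z.1‖ ≤ 1 / 2 → LipschitzWith (1 / 2) z.1 →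
      φ (j z) = φ (j P) - 1 + z.1 s := by
    intro z hzn hzl
    have hz : ∀ r, |z.1 r| ≤ 1 / 2 := fun r ↦ (z.1.norm_coe_le_norm r).trans hzn
    have hzs : ∀ r, |z.1 r - z.1 s| ≤ 1 / 2 * dist r s := fun r ↦ by
      simpa [Real.dist_eq] using hzl.dist_le_mul r s
    have h₁ : dist P z ≤ 1 - z.1 s := by
      refine (ContinuousMap.dist_le (by linarith [abs_le.1 (hz s)])).2 fun r ↦ ?_
      change |1 - dist r s - z.1 r| ≤ _
      have := abs_le.1 (hzs r)
      have := abs_le.1 (hz r)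
      have := abs_le.1 (hz s)
      rw [abs_le]
      constructor <;> linarith [hdist r, dist_nonneg (x := r) (y := s)]
    have h₂ : dist z N ≤ 1 + z.1 s := by
      refine (ContinuousMap.dist_le (by linarith [abs_le.1 (hz s)])).2 fun r ↦ ?_
      change |z.1 r - -(1 - dist r s)| ≤ _
      have := abs_le.1 (hzs r)
      have := abs_le.1 (hz r)
      have := abs_le.1 (hz s)
      rw [abs_le]
      constructor <;> linarith [hdist r, dist_nonneg (x := r) (y := s)]
    linarith [hφle P z, hφle z N]
  refine ⟨φ, hφ, fun z z' hz hz' hw hw' ↦ ?_⟩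
  rw [map_sub, key z hz hz', key z' hw hw']
  ring

theorem lipschitzWith_cubeMap {x : ℕ → C(I, ℝ)} (hx : ∀ k, ‖x k‖ ≤ (1 / 2) ^ (k + 3))
    (hl : ∀ k s r, |x k s - x k r| ≤ (1 / 2) ^ (k + 3) * dist s r) (t : ℕ → ℝ) :
    LipschitzWith (1 / 2) (cubeMap x t : C(I, ℝ)) := by
  refine LipschitzWith.of_dist_le_mul fun s r ↦ ?_
  have happ : ∀ s, HasSum (fun k ↦ clamp (t k) * x k s) (cubeMap x t s) := fun s ↦ by
    simpa using! ContinuousMap.hasSum_apply (summable_clamp_smul hx t).hasSum s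
  rw [dist_eq_norm, ← ((happ s).sub (happ r)).tsum_eq]
  refine tsum_of_norm_bounded (hasSum_half_pow_add_two.mul_right (dist s r)) fun k ↦ ?_
  rw [← mul_sub]
  exact abs_clamp_mul_le (t k) (hl k s r)

theorem exists_denseRange_linearCombination :
    ∃ x : ℕ → C(I, ℝ), (∀ k, ‖x k‖ ≤ (1 / 2) ^ (k + 3)) ∧
      (∀ k s r, |x k s - x k r| ≤ (1 / 2) ^ (k + 3) * dist s r) ∧
      DenseRange (Finsupp.linearCombination ℝ x) := by
  let m : ℕ → C(I, ℝ) := fun k ↦ ⟨fun s ↦ (s : ℝ) ^ k, by fun_prop⟩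
  let c : ℕ → ℝ := fun k ↦ (1 / 2) ^ (k + 3) / (k + 1)
  have hc : ∀ k, 0 < c k := fun k ↦ by positivity
  have hck : ∀ k, c k * (k + 1) = (1 / 2) ^ (k + 3) := fun k ↦ by
    simp only [c]
    field_simp
  refine ⟨fun k ↦ c k • m k, fun k ↦ ?_, fun k s r ↦ ?_, ?_⟩
  · have hm : ‖m k‖ ≤ 1 := (ContinuousMap.norm_le _ zero_le_one).2 fun s ↦ by
      simpa [m, abs_of_nonneg s.2.1] using! pow_le_one₀ s.2.1 s.2.2
    rw [norm_smul, Real.norm_of_nonneg (hc k).le, ← hck]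
    have := hc k
    gcongr
    linarith [k.cast_nonneg (α := ℝ)]
  · have h : |(s : ℝ) ^ k - (r : ℝ) ^ k| ≤ (k + 1) * dist s r := by
      refine (abs_pow_sub_pow_le _ _ _).trans ?_
      have hmax : max |(s : ℝ)| |(r : ℝ)| ^ (k - 1) ≤ 1 := by
        refine pow_le_one₀ (le_max_of_le_left (abs_nonneg _)) ?_
        rw [abs_of_nonneg s.2.1, abs_of_nonneg r.2.1]
        exact max_le s.2.2 r.2.2
      change |(s : ℝ) - r| * k * _ ≤ (k + 1) * |(s : ℝ) - r|
      nlinarith [mul_nonneg (abs_nonneg ((s : ℝ) - r)) k.cast_nonneg, abs_nonneg ((s : ℝ) - r)]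
    change |c k * (s : ℝ) ^ k - c k * (r : ℝ) ^ k| ≤ _
    rw [← mul_sub, abs_mul, abs_of_pos (hc k), ← hck, mul_assoc]
    have := hc k
    gcongr
  · intro f
    refine closure_mono ?_ (continuousMap_mem_polynomialFunctions_closure 0 1 f)
    rintro _ ⟨p, -, rfl⟩
    rw [← LinearMap.coe_range, Finsupp.range_linearCombination, SetLike.mem_coe]
    have hp : (Polynomial.toContinuousMapOnAlgHom I p : C(I, ℝ)) =
        ∑ k ∈ p.support, (p.coeff k / c k) • (c k • m k) := by
      ext s
      have := fun k ↦ (hc k).ne'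
      simp [m, smul_smul, this, Polynomial.eval_eq_sum, Polynomial.sum]
    change (Polynomial.toContinuousMapOnAlgHom I p : C(I, ℝ)) ∈ _
    rw [hp]
    exact Submodule.sum_mem _ fun k _ ↦
      Submodule.smul_mem _ _ (Submodule.subset_span (Set.mem_range_self k))

/-- A complete normed space containing an isometric copy of the `1`-Lipschitz functions in the unit
ball of `C([0,1])` contains an isometric copy of all of `C([0,1])`. -/
theorem exists_isometry_continuousMap_of_isometry {Y : Type*} [NormedAddCommGroup Y]
    [NormedSpace ℝ Y] [CompleteSpace Y] {j : unitLipschitz → Y} (hj : Isometry j) :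
    ∃ J : C(I, ℝ) → Y, Isometry J := by
  obtain ⟨x, hx, hl, hd⟩ := exists_denseRange_linearCombination
  have hhalf : ∀ t, LipschitzWith (1 / 2) (cubeMap x t : C(I, ℝ)) := lipschitzWith_cubeMap hx hl
  let S : (ℕ → ℝ) → unitLipschitz := fun t ↦
    ⟨cubeMap x t, (norm_cubeMap_le hx t).trans (by norm_num),
      (hhalf t).weaken (by simp)⟩
  have hS : ∀ t t', ‖j (S t) - j (S t')‖ = ‖cubeMap x t - cubeMap x t'‖ := fun t t' ↦ by
    rw [← dist_eq_norm, hj.dist_eq, ← dist_eq_norm]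
    rfl
  have hf : CoordLipschitz (fun k ↦ ‖x k‖) fun t ↦ j (S t) :=
    { continuous := hj.continuous.comp ((continuous_cubeMap hx).subtype_mk _)
      bounded := ⟨1 + ‖j (S 0)‖, fun t ↦ by
        have h₁ := norm_le_norm_sub_add (j (S t)) (j (S 0))
        have h₂ := norm_sub_le (cubeMap x t) (cubeMap x 0)
        linarith [hS t 0, norm_cubeMap_le hx t, norm_cubeMap_le hx 0]⟩
      norm_add_single_sub_le := fun t n b ↦ by
        rw [hS]
        exact norm_cubeMap_add_single_sub_le hx t n b }
  let R : (ℕ →₀ ℝ) →ₗ[ℝ] Y := Finsupp.linearCombination ℝ (cubeDiff fun t ↦ j (S t))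
  have hupper : ∀ a, ‖R a‖ ≤ ‖Finsupp.linearCombination ℝ x a‖ := by
    intro a
    refine hf.norm_linearCombination_cubeDiff_le ?_
    filter_upwards [eventually_forall_abs_mul_le_one a, self_mem_nhdsWithin] with ε hε hpos
    filter_upwards [ae_cubeMeasure_mem_Ioc] with t ht
    rw [hS, cubeMap_add_smul_sub hx ht hε, norm_smul, Real.norm_of_nonneg (Set.mem_Ioi.1 hpos).le]
  have hlower : ∀ a, ‖Finsupp.linearCombination ℝ x a‖ ≤ ‖R a‖ := by
    intro a
    refine (ContinuousMap.norm_le _ (norm_nonneg _)).2 fun s ↦ ?_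
    obtain ⟨φ, hφ, hφS⟩ := exists_dual_eq_eval hj s
    have hφn : ∀ n, φ (cubeDiff (fun t ↦ j (S t)) n) = x n s := by
      intro n
      refine hf.map_cubeDiff_eq φ n fun t ↦ ?_
      exact (hφS (S _) (S _) (norm_cubeMap_le hx _) (hhalf _) (norm_cubeMap_le hx _)
        (hhalf _)).trans (congrArg (fun f : C(I, ℝ) ↦ f s) (cubeMap_update_sub hx t n))
    have hφR : Finsupp.linearCombination ℝ x a s = φ (R a) := by
      simp [R, Finsupp.linearCombination_apply, Finsupp.sum, hφn]
    rw [hφR]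
    exact (φ.le_of_opNorm_le hφ _).trans_eq (one_mul _)
  refine exists_isometry_of_denseRange hd R fun a b ↦ ?_
  rw [dist_eq_norm, dist_eq_norm, ← map_sub, ← map_sub]
  exact le_antisymm (hupper _) (hlower _)

end Interval

universe u

/-- Let `K₀ = {f ∈ C([0,1]) : ‖f‖∞ ≤ 1 and f is 1-Lipschitz}`. If a real
Banach space `Y` contains an isometric copy of `K₀`, then every separable metric space admits
a distance-preserving map into `Y`. -/
theorem stmt4 (Y : Type*) [NormedAddCommGroup Y] [NormedSpace ℝ Y] [CompleteSpace Y]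
    (h : ∃ j : {f : C(Set.Icc (0:ℝ) 1, ℝ) | ‖f‖ ≤ 1 ∧ LipschitzWith 1 f} → Y, Isometry j) :
    ∀ (M : Type u) [MetricSpace M] [TopologicalSpace.SeparableSpace M],
      ∃ j : M → Y, Isometry j := by
  intro M _ _
  obtain ⟨j, hj⟩ := h
  rcases isEmpty_or_nonempty M with hM | hM
  · exact ⟨fun _ ↦ 0, fun m ↦ hM.elim m⟩
  · obtain ⟨J, hJ⟩ := exists_isometry_continuousMap_of_isometry hj
    obtain ⟨E, hE⟩ := exists_isometry_cantor_to_interval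
    obtain ⟨e, he⟩ := exists_isometry_to_cantor M
    exact ⟨J ∘ E ∘ e, hJ.comp (hE.comp he)⟩
end
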